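/- (Best response for large p_M.) Assume p₀ ≤ θ. Let R : ℝ → ℝ be any residual demand function satisfying 0 ≤ R(p) ≤ Q(p) for all p ≥ 0, and let the marketplace operator's price satisfy p_M ≥ p⋆. Define the independent seller's utility u(p) = ((1−α)p − c_I)·Q(p) for p ≤ p_M and u(p) = ((1−α)p − c_I)·R(p) for p > p_M. Then u(p⋆) ≥ u(p) for all p ≥ 0; that is, the sole-seller price p⋆ is a best response. -/

import Mathlib

/-- Best response for large `p_M`: If `p_M ≥ p⋆` and `R` is any
residual demand with `0 ≤ R(p) ≤ Q(p)` for `p ≥ 0`, then the sole-seller price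
`p⋆ = (p₀ + θ)/2` maximizes the independent seller's utility
`u(p) = ((1−α)p − c_I)·Q(p)` for `p ≤ p_M`, `((1−α)p − c_I)·R(p)` for `p > p_M`. -/
theorem stmt_3 (θ α cI pM : ℝ) (R : ℝ → ℝ) (hθ : 0 < θ) (hα0 : 0 ≤ α)
    (hα1 : α < 1) (hcI : 0 ≤ cI) (hp0 : cI / (1 - α) ≤ θ)
    (hpM : pM ≥ (cI / (1 - α) + θ) / 2)
    (hR : ∀ p : ℝ, 0 ≤ p → 0 ≤ R p ∧ R p ≤ max (θ - p) 0) :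
    ∀ p : ℝ, 0 ≤ p →
      (fun p' : ℝ => if p' ≤ pM then ((1 - α) * p' - cI) * max (θ - p') 0
          else ((1 - α) * p' - cI) * R p') p
        ≤ (fun p' : ℝ => if p' ≤ pM then ((1 - α) * p' - cI) * max (θ - p') 0
          else ((1 - α) * p' - cI) * R p') ((cI / (1 - α) + θ) / 2) := by
  intro p hp
  have hk : 0 < 1 - α := by linarith
  obtain ⟨q, hq⟩ : ∃ q, q = cI / (1 - α) := ⟨_, rfl⟩
  have hc : cI = (1 - α) * q := by rw [hq]; field_simp
  rw [← hq] at hp0 hpM ⊢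
  have key : ∀ r : ℝ, 0 ≤ r → r ≤ max (θ - p) 0 →
      ((1 - α) * p - cI) * r ≤ (1 - α) * ((θ - q) ^ 2 / 4) := by
    intro r h0 h1
    have e : ((1 - α) * p - cI) * r = (1 - α) * ((p - q) * r) := by rw [hc]; ring
    rw [e]
    apply mul_le_mul_of_nonneg_left _ hk.le
    rcases le_total p q with h | h
    · nlinarith [mul_nonneg (sub_nonneg.2 h) h0, sq_nonneg (θ - q)]
    · have h2 := mul_le_mul_of_nonneg_left h1 (sub_nonneg.2 h)
      rcases le_total (θ - p) 0 with h3 | h3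
      · rw [max_eq_right h3] at h2
        nlinarith [sq_nonneg (θ - q)]
      · rw [max_eq_left h3] at h2
        nlinarith [sq_nonneg (θ + q - 2 * p)]
  have hs : ((1 - α) * ((q + θ) / 2) - cI) * max (θ - (q + θ) / 2) 0
      = (1 - α) * ((θ - q) ^ 2 / 4) := by
    rw [max_eq_left (by linarith), hc]; ring
  beta_reduce
  rw [if_pos hpM.le, hs]
  split_ifs
  · exact key _ (le_max_right _ _) le_rfl
  · exact key _ (hR p hp).1 (hR p hp).2
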